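/- Define the linear map M2 on (ℝ²)^{n²} by (M2 A)_u = A_{(u, τ_k(u))} for u ∈ [k], (M2 A)_u = A_{(τ_k(u−k), u−k)} for u ∈ {k+1, …, 2k}, and all other coordinates of M2 A equal to (0,0) (viewing u ∈ [2k] as the u-th element of [n²]). Then for every D_I-invariant function ψ : X → ℝ there exists a block-S_{n²}-invariant function φ : (ℝ²)^{n²} × (ℝ²)^n → ℝ such that ψ(x) = φ(M2(ρ_n(M1 x)), Q(x)) for all x ∈ X. -/

import Mathlib

/-- Action of a permutation `g` on tuples: `(g · x)_i = x_{g i}`. -/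
def permAct {ι α : Type*} (g : Equiv.Perm ι) (x : ι → α) : ι → α := fun i => x (g i)

/-- `X`: points of `[0,1]^n` with pairwise distinct coordinates. -/
def Xset (n : ℕ) : Set (Fin n → ℝ) :=
  {x | (∀ i, x i ∈ Set.Icc (0 : ℝ) 1) ∧ Function.Injective x}

/-- `ρ_n(x)_{(a,b)} = (x_a, x_b)`, indexing `(ℝ²)^{n²}` by `[n] × [n]`
(lexicographically: the pair `(a,b)` is the element number `a·n + b` of `[n²]`,
zero-indexed). -/
def rhoN (n : ℕ) (x : Fin n → ℝ) : Fin n × Fin n → ℝ × ℝ := fun p => (x p.1, x p.2)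

/-- `M1`: `(M1 x)_u = x_{i_u}` for `u ∈ [k]` and `0` otherwise, where
`e : Fin k → Fin n` enumerates `I = {i_1 < … < i_k}`. -/
def M1map (n k : ℕ) (e : Fin k → Fin n) (x : Fin n → ℝ) : Fin n → ℝ :=
  fun u => if h : u.val < k then x (e ⟨u.val, h⟩) else 0

/-- `Q(x)_u = (((I_n − M1)x)_u, 0)`. -/
def Qmap (n k : ℕ) (e : Fin k → Fin n) (x : Fin n → ℝ) : Fin n → ℝ × ℝ :=
  fun u => (x u - M1map n k e x u, 0)

/-- `M2` for the locally dihedral case: the `u`-th coordinate of `M2 A`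
(viewing `u ∈ [2k]` as the `u`-th element of `[n²]` lexicographically, i.e.
the pair at zero-indexed lex position `q.1 * n + q.2`) is `A_{(u, τ_k(u))}` for
`u ∈ [k]`, `A_{(τ_k(u-k), u-k)}` for `u ∈ {k+1,…,2k}`, and `(0,0)` otherwise. -/
def M2D (n k : ℕ) (hkn : k ≤ n) (A : Fin n × Fin n → ℝ × ℝ) :
    Fin n × Fin n → ℝ × ℝ := fun q =>
  if h : q.1.val * n + q.2.val < k then
    A (Fin.castLE hkn ⟨q.1.val * n + q.2.val, h⟩,
       Fin.castLE hkn (finRotate k ⟨q.1.val * n + q.2.val, h⟩))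
  else if h2 : q.1.val * n + q.2.val < 2 * k then
    A (Fin.castLE hkn (finRotate k ⟨q.1.val * n + q.2.val - k, by omega⟩),
       Fin.castLE hkn ⟨q.1.val * n + q.2.val - k, by omega⟩)
  else 0

theorem finRotate_rev_finRotate {k : ℕ} (u : Fin k) :
    finRotate k (Fin.rev (finRotate k u)) = Fin.rev u := by
  cases k with
  | zero => exact u.elim0
  | succ m =>
    rw [finRotate_apply, finRotate_apply, Fin.rev_add, sub_add_cancel]

theorem finRotate_apply_ne {k : ℕ} (hk : 2 ≤ k) (u : Fin k) : finRotate k u ≠ u := by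
  obtain ⟨m, rfl⟩ := Nat.exists_eq_add_of_le' hk
  have h : u ∈ (finRotate (m + 2)).support := by simp [support_finRotate]
  exact Equiv.Perm.mem_support.mp h

theorem finRotate_finRotate_apply_ne {k : ℕ} (hk : 3 ≤ k) (u : Fin k) :
    finRotate k (finRotate k u) ≠ u := by
  obtain ⟨m, rfl⟩ := Nat.exists_eq_add_of_le' hk
  rw [finRotate_apply, finRotate_apply, add_assoc]
  intro h
  have h2 := congrArg Fin.val (left_eq_add.mp h.symm)
  simp [Fin.val_add, Nat.mod_eq_of_lt] at h2

theorem exists_finRotate_pow_apply_eq {k : ℕ} (hk : 2 ≤ k) (u v : Fin k) :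
    ∃ m : ℕ, (finRotate k ^ m) u = v := by
  obtain ⟨m, rfl⟩ := Nat.exists_eq_add_of_le' hk
  exact isCycle_finRotate.exists_pow_eq (finRotate_apply_ne hk u) (finRotate_apply_ne hk v)

/-- A self-map of the `k`-cycle commuting with the rotation is a power of the rotation. -/
theorem exists_eq_finRotate_pow {k : ℕ} (hk : 2 ≤ k) (d : Fin k → Fin k)
    (hd : ∀ u, d (finRotate k u) = finRotate k (d u)) :
    ∃ m : ℕ, ∀ u, d u = (finRotate k ^ m) u := by
  obtain ⟨m, hm⟩ := exists_finRotate_pow_apply_eq hk ⟨0, by omega⟩ (d ⟨0, by omega⟩)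
  refine ⟨m, fun u => ?_⟩
  obtain ⟨j, rfl⟩ := exists_finRotate_pow_apply_eq hk ⟨0, by omega⟩ u
  rw [← Equiv.Perm.mul_apply, ← pow_add, add_comm, pow_add, Equiv.Perm.mul_apply, hm]
  clear hm
  induction j with
  | zero => rfl
  | succ j ih => rw [pow_succ', Equiv.Perm.mul_apply, hd, ih, Equiv.Perm.mul_apply]

/-- An injective self-map of the `k`-cycle preserving adjacency is a dihedral symmetry. -/
theorem exists_eq_finRotate_pow_or_rev {k : ℕ} (hk : 3 ≤ k) (d : Fin k → Fin k)
    (hinj : Function.Injective d)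
    (hd : ∀ u, d (finRotate k u) = finRotate k (d u) ∨ finRotate k (d (finRotate k u)) = d u) :
    (∃ m : ℕ, ∀ u, d u = (finRotate k ^ m) u) ∨
      ∃ m : ℕ, ∀ u, d u = (finRotate k ^ m) (Fin.rev u) := by
  by_cases h : ∃ u, d (finRotate k u) = finRotate k (d u)
  · left
    obtain ⟨u, hu⟩ := h
    refine exists_eq_finRotate_pow (by omega) d fun v => ?_
    obtain ⟨j, rfl⟩ := exists_finRotate_pow_apply_eq (by omega) u v
    induction j with
    | zero => exact hu
    | succ j ih =>
      rw [pow_succ', Equiv.Perm.mul_apply]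
      set w := (finRotate k ^ j) u
      refine (hd (finRotate k w)).resolve_right fun h' => ?_
      rw [ih] at h'
      exact finRotate_finRotate_apply_ne hk w (hinj ((finRotate k).injective h'))
  · right
    push Not at h
    obtain ⟨m, hm⟩ := exists_eq_finRotate_pow (by omega) (fun u => d (Fin.rev u)) fun u => by
      have h1 := (hd (Fin.rev (finRotate k u))).resolve_left (h _)
      rw [finRotate_rev_finRotate] at h1
      exact h1.symm
    exact ⟨m, fun u => by simpa using hm (Fin.rev u)⟩

theorem val_le_val_of_strictMono {n k : ℕ} {e : Fin k → Fin n} (he : StrictMono e) (u : Fin k) :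
    u.val ≤ (e u).val := by
  obtain ⟨u, hu⟩ := u
  induction u with
  | zero => exact Nat.zero_le _
  | succ u ih =>
    have h1 := ih (by omega)
    have h2 : e ⟨u, by omega⟩ < e ⟨u + 1, hu⟩ := he (by simp)
    have h3 : (e ⟨u, by omega⟩).val < (e ⟨u + 1, hu⟩).val := h2
    simp only at h1 ⊢
    omega

/-- `Q` determines every coordinate beyond the initial segment on which `e` is the inclusion. -/
theorem eq_of_Qmap_eq {n k : ℕ} {e : Fin k → Fin n} (he : StrictMono e) {x y : Fin n → ℝ}
    (hQ : Qmap n k e x = Qmap n k e y) (j : Fin n)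
    (hj : ∀ h : j.val < k, j < e ⟨j.val, h⟩) : x j = y j := by
  have h1 := congrArg Prod.fst (congrFun hQ j)
  simp only [Qmap, M1map] at h1
  split_ifs at h1 with h
  · have h2 : x (e ⟨j.val, h⟩) = y (e ⟨j.val, h⟩) :=
      eq_of_Qmap_eq he hQ (e ⟨j.val, h⟩) fun h' => he (hj h)
    linarith
  · linarith
termination_by n - j.val
decreasing_by
  have := hj h
  omega

theorem eq_of_Qmap_eq_of_notMem_range {n k : ℕ} {e : Fin k → Fin n} (he : StrictMono e)
    {x y : Fin n → ℝ} (hQ : Qmap n k e x = Qmap n k e y) {j : Fin n} (hj : j ∉ Set.range e) :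
    x j = y j :=
  eq_of_Qmap_eq he hQ j fun h =>
    lt_of_le_of_ne (val_le_val_of_strictMono he ⟨j.val, h⟩) fun h' => hj ⟨_, h'.symm⟩

theorem M1map_castLE {n k : ℕ} (hkn : k ≤ n) (e : Fin k → Fin n) (x : Fin n → ℝ) (u : Fin k) :
    M1map n k e x (Fin.castLE hkn u) = x (e u) := by
  simp [M1map]

/-- The values of `M2 (ρ_n (M1 x))` are the directed edges of the cycle on `I`, and zero. -/
theorem M2D_rhoN_eq {n k : ℕ} (hkn : k ≤ n) (e : Fin k → Fin n) (x : Fin n → ℝ)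
    (q : Fin n × Fin n) :
    (∃ v, M2D n k hkn (rhoN n (M1map n k e x)) q = (x (e v), x (e (finRotate k v)))) ∨
      (∃ v, M2D n k hkn (rhoN n (M1map n k e x)) q = (x (e (finRotate k v)), x (e v))) ∨
      M2D n k hkn (rhoN n (M1map n k e x)) q = 0 := by
  unfold M2D
  split_ifs with h h2
  · exact Or.inl ⟨_, by simp only [rhoN, M1map_castLE]; rfl⟩
  · exact Or.inr (Or.inl ⟨_, by simp only [rhoN, M1map_castLE]; rfl⟩)
  · exact Or.inr (Or.inr rfl)

theorem exists_M2D_rhoN_eq {n k : ℕ} (hkn : k ≤ n) (e : Fin k → Fin n) (x : Fin n → ℝ)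
    (u : Fin k) :
    ∃ q, M2D n k hkn (rhoN n (M1map n k e x)) q = (x (e u), x (e (finRotate k u))) := by
  have hn : 0 < n := u.pos.trans_le hkn
  refine ⟨(⟨0, hn⟩, Fin.castLE hkn u), ?_⟩
  simp [M2D, rhoN, M1map_castLE]

/-- The unordered values of `M2 (ρ_n (M1 x))` determine `x` on `I` up to a dihedral symmetry. -/
theorem exists_dihedral_of_M2D_eq {n k : ℕ} (hk : 3 ≤ k) (hkn : k ≤ n) {e : Fin k → Fin n}
    (he : Function.Injective e) {x y : Fin n → ℝ} (hx : Function.Injective x)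
    (hy : Function.Injective y) {g : Equiv.Perm (Fin n × Fin n)}
    (hg : permAct g (M2D n k hkn (rhoN n (M1map n k e x))) =
      M2D n k hkn (rhoN n (M1map n k e y))) :
    (∃ m : ℕ, ∀ u, y (e u) = x (e ((finRotate k ^ m) u))) ∨
      ∃ m : ℕ, ∀ u, y (e u) = x (e ((finRotate k ^ m) (Fin.rev u))) := by
  have hedge : ∀ u, ∃ v,
      (y (e u) = x (e v) ∧ y (e (finRotate k u)) = x (e (finRotate k v))) ∨
      (y (e u) = x (e (finRotate k v)) ∧ y (e (finRotate k u)) = x (e v)) := by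
    intro u
    obtain ⟨q, hq⟩ := exists_M2D_rhoN_eq hkn e y u
    rw [← hg, permAct] at hq
    rcases M2D_rhoN_eq hkn e x (g q) with ⟨v, hv⟩ | ⟨v, hv⟩ | h0
    · rw [hv, Prod.mk.injEq] at hq
      exact ⟨v, Or.inl ⟨hq.1.symm, hq.2.symm⟩⟩
    · rw [hv, Prod.mk.injEq] at hq
      exact ⟨v, Or.inr ⟨hq.1.symm, hq.2.symm⟩⟩
    · rw [h0, Prod.ext_iff] at hq
      exact absurd (he (hy (hq.2.symm.trans hq.1))) (finRotate_apply_ne (by omega) u)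
  have hd : ∀ u, ∃ v, y (e u) = x (e v) := fun u => by
    obtain ⟨v, h | h⟩ := hedge u
    exacts [⟨_, h.1⟩, ⟨_, h.1⟩]
  choose d hd using hd
  have hxe : Function.Injective (x ∘ e) := hx.comp he
  have key := exists_eq_finRotate_pow_or_rev hk d
    (fun u v huv => he (hy (by rw [hd u, hd v, huv]))) fun u => by
      obtain ⟨v, ⟨h1, h2⟩ | ⟨h1, h2⟩⟩ := hedge u
      · left
        rw [hd] at h1 h2
        rw [hxe h1, hxe h2]
      · right
        rw [hd] at h1 h2
        rw [hxe h1, hxe h2]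
  simp only [hd]
  rcases key with ⟨m, hm⟩ | ⟨m, hm⟩
  · exact Or.inl ⟨m, fun u => by rw [hm]⟩
  · exact Or.inr ⟨m, fun u => by rw [hm]⟩

theorem pow_apply_of_semiconj {α β : Type*} {π : Equiv.Perm α} {r : Equiv.Perm β} {e : β → α}
    (h : ∀ u, π (e u) = e (r u)) (m : ℕ) (u : β) : (π ^ m) (e u) = e ((r ^ m) u) := by
  induction m with
  | zero => rfl
  | succ m ih => rw [pow_succ', pow_succ', Equiv.Perm.mul_apply, Equiv.Perm.mul_apply, ih, h]

/-- Any `D_I`-invariant `ψ : X → ℝ` is expressible as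
`x ↦ φ(M2(ρ_n(M1 x)), Q(x))` with `φ` block-`S_{n²}`-invariant. Here `π, σ ∈ S_n`
are the local cyclic shift and the local reversal on `I`, and `D_I = ⟨π, σ⟩`. -/
theorem stmt_11 (n k : ℕ) (hn : 2 ≤ n) (hk : 3 ≤ k) (hkn : k ≤ n)
    (e : Fin k → Fin n) (he : StrictMono e)
    (π σ : Equiv.Perm (Fin n))
    (hπ : ∀ u : Fin k, π (e u) = e (finRotate k u))
    (hπ' : ∀ j, j ∉ Set.range e → π j = j)
    (hσ : ∀ u : Fin k, σ (e u) = e (Fin.revPerm u))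
    (hσ' : ∀ j, j ∉ Set.range e → σ j = j)
    (ψ : (Fin n → ℝ) → ℝ)
    (hψ : ∀ g ∈ Subgroup.closure {π, σ}, ∀ x ∈ Xset n, ψ (permAct g x) = ψ x) :
    ∃ φ : ((Fin n × Fin n → ℝ × ℝ) × (Fin n → ℝ × ℝ)) → ℝ,
      (∀ (g : Equiv.Perm (Fin n × Fin n)) (A : Fin n × Fin n → ℝ × ℝ)
        (q : Fin n → ℝ × ℝ), φ (permAct g A, q) = φ (A, q)) ∧
      ∀ x ∈ Xset n,
        ψ x = φ (M2D n k hkn (rhoN n (M1map n k e x)), Qmap n k e x) := by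
  classical
  let P : (Fin n × Fin n → ℝ × ℝ) → (Fin n → ℝ × ℝ) → (Fin n → ℝ) → Prop := fun A q x =>
    x ∈ Xset n ∧ (∃ g : Equiv.Perm (Fin n × Fin n),
      permAct g (M2D n k hkn (rhoN n (M1map n k e x))) = A) ∧ Qmap n k e x = q
  have hP : ∀ (g : Equiv.Perm (Fin n × Fin n)) A q, P (permAct g A) q = P A q := by
    intro g A q
    funext x
    refine propext (and_congr_right fun _ => and_congr_left fun _ => ⟨?_, ?_⟩)
    · rintro ⟨g', h⟩
      refine ⟨g' * g⁻¹, funext fun i => ?_⟩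
      have := congrFun h (g⁻¹ i)
      simpa [permAct] using this
    · rintro ⟨g', rfl⟩
      exact ⟨g' * g, rfl⟩
  have hunique : ∀ x ∈ Xset n, ∀ y ∈ Xset n, ∀ g : Equiv.Perm (Fin n × Fin n),
      permAct g (M2D n k hkn (rhoN n (M1map n k e x))) =
        M2D n k hkn (rhoN n (M1map n k e y)) →
      Qmap n k e x = Qmap n k e y → ψ y = ψ x := by
    intro x hx y hy g hg hQ
    have hπm : ∀ m : ℕ, ∀ j, j ∉ Set.range e → (π ^ m) j = j := fun m j hj =>
      Equiv.Perm.pow_apply_eq_self_of_apply_eq_self (hπ' j hj) m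
    have hπG : ∀ m : ℕ, π ^ m ∈ Subgroup.closure {π, σ} := fun m =>
      pow_mem (Subgroup.subset_closure (by simp)) m
    have hσG : σ ∈ Subgroup.closure {π, σ} := Subgroup.subset_closure (by simp)
    suffices h : ∃ d ∈ Subgroup.closure {π, σ}, permAct d x = y by
      obtain ⟨d, hd, rfl⟩ := h
      exact hψ d hd x hx
    rcases exists_dihedral_of_M2D_eq hk hkn he.injective hx.2 hy.2 hg with ⟨m, hm⟩ | ⟨m, hm⟩
    · refine ⟨π ^ m, hπG m, funext fun j => ?_⟩
      by_cases hj : j ∈ Set.range e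
      · obtain ⟨u, rfl⟩ := hj
        rw [permAct, pow_apply_of_semiconj hπ, hm]
      · rw [permAct, hπm m j hj, eq_of_Qmap_eq_of_notMem_range he hQ hj]
    · refine ⟨π ^ m * σ, mul_mem (hπG m) hσG, funext fun j => ?_⟩
      by_cases hj : j ∈ Set.range e
      · obtain ⟨u, rfl⟩ := hj
        rw [permAct, Equiv.Perm.mul_apply, hσ, pow_apply_of_semiconj hπ, hm, Fin.revPerm_apply]
      · rw [permAct, Equiv.Perm.mul_apply, hσ' j hj, hπm m j hj,
          eq_of_Qmap_eq_of_notMem_range he hQ hj]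
  refine ⟨fun p => if h : ∃ x, P p.1 p.2 x then ψ h.choose else 0, ?_, ?_⟩
  · intro g A q
    simp only [hP]
  · intro x hx
    have h : ∃ z, P (M2D n k hkn (rhoN n (M1map n k e x))) (Qmap n k e x) z :=
      ⟨x, hx, ⟨1, rfl⟩, rfl⟩
    simp only [dif_pos h]
    obtain ⟨hz, ⟨g, hg⟩, hQ⟩ := h.choose_spec
    exact hunique _ hz x hx g hg hQ
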